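/- arXiv:1706.01877 — 4 statements merged into one kernel-verified Lean document; each statement's English description precedes it below -/
import Mathlib

section
/- Let A be a unital C*-algebra and a ∈ A. The following statements are equivalent: (i) a is core invertible; (ii) a is dual core invertible; (iii) a* is core invertible; (iv) a* is dual core invertible; (v) a is both group invertible and Moore-Penrose invertible. In particular, the set of core invertible elements of A, the set of dual core invertible elements of A, and the set of group invertible elements of A all coincide. -/
/-- `x` is a Moore–Penrose inverse of `a`. -/
def IsMPInv {A : Type*} [Ring A] [StarRing A] (a x : A) : Prop :=
  a * x * a = a ∧ x * a * x = x ∧ star (a * x) = a * x ∧ star (x * a) = x * a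

/-- `x` is a group inverse of `a`. -/
def IsGroupInv {A : Type*} [Ring A] (a x : A) : Prop :=
  a * x * a = a ∧ x * a * x = x ∧ a * x = x * a

/-- `x` is a core inverse of `a`: `a·x·a = a`, `x·A = a·A`, `A·x = A·a*`. -/
def IsCoreInv {A : Type*} [Ring A] [StarRing A] (a x : A) : Prop :=
  a * x * a = a ∧ (Set.range fun y => x * y) = (Set.range fun y => a * y) ∧
    (Set.range fun y => y * x) = (Set.range fun y => y * star a)

/-- `x` is a dual core inverse of `a`: `a·x·a = a`, `x·A = a*·A`, `A·x = A·a`. -/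
def IsDualCoreInv {A : Type*} [Ring A] [StarRing A] (a x : A) : Prop :=
  a * x * a = a ∧ (Set.range fun y => x * y) = (Set.range fun y => star a * y) ∧
    (Set.range fun y => y * x) = (Set.range fun y => y * a)

/-- A core inverse `x` of `a` satisfies `x = x (a x)*`, hence `x a x = x`. -/
theorem IsCoreInv.mul_mul_self {A : Type*} [Ring A] [StarRing A] {a x : A} (h : IsCoreInv a x) :
    x * a * x = x := by
  obtain ⟨h1, -, h3⟩ := h
  obtain ⟨w, hw⟩ : x ∈ Set.range fun y => y * star a := h3 ▸ ⟨1, one_mul x⟩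
  have hw : w * star a = x := hw
  have hs : star a * star (a * x) = star a := by rw [← star_mul, h1]
  have hx : x * star (a * x) = x := by
    calc x * star (a * x) = w * (star a * star (a * x)) := by rw [← mul_assoc, hw]
      _ = x := by rw [hs, hw]
  have hax : star (a * x) = a * x := by
    have h4 : a * x * star (a * x) = a * x := by rw [mul_assoc, hx]
    rw [← h4, star_mul, star_star]
  rw [mul_assoc, ← hax, hx]

theorem IsCoreInv.exists_isGroupInv {A : Type*} [Ring A] [StarRing A] {a x : A}
    (h : IsCoreInv a x) : ∃ g, IsGroupInv a g := by
  have hx := h.mul_mul_self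
  obtain ⟨h1, h2, -⟩ := h
  obtain ⟨u, hu⟩ : a ∈ Set.range fun y => x * y := h2 ▸ ⟨1, mul_one a⟩
  obtain ⟨v, hv⟩ : x ∈ Set.range fun y => a * y := h2 ▸ ⟨1, mul_one x⟩
  have hu : x * u = a := hu
  have hv : a * v = x := hv
  have hl : x * a * a = a := by
    calc x * a * a = x * a * x * u := by rw [mul_assoc _ x, hu]
      _ = a := by rw [hx, hu]
  have haw : a * (v * a) = x * a := by rw [← mul_assoc, hv]
  have hag : a * (x * a * (v * a)) = x * a := by
    rw [← mul_assoc, ← mul_assoc a x, h1, haw]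
  have hga : x * a * (v * a) * a = x * a := by
    rw [mul_assoc x, haw, mul_assoc, hl]
  refine ⟨x * a * (v * a), ?_, ?_, hag.trans hga.symm⟩
  · rw [hag, hl]
  · rw [hga, ← mul_assoc, ← mul_assoc (x * a) x, hx]

theorem isGroupInv_star {A : Type*} [Ring A] [StarRing A] {a g : A} (h : IsGroupInv a g) :
    IsGroupInv (star a) (star g) := by
  obtain ⟨h1, h2, h3⟩ := h
  refine ⟨?_, ?_, ?_⟩
  · rw [← star_mul, ← star_mul, ← mul_assoc, h1]
  · rw [← star_mul, ← star_mul, ← mul_assoc, h2]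
  · rw [← star_mul, ← star_mul, h3]

theorem range_star_mul_eq_iff {A : Type*} [Ring A] [StarRing A] {b c : A} :
    (Set.range fun y => star b * y) = (Set.range fun y => star c * y) ↔
      (Set.range fun y => y * b) = (Set.range fun y => y * c) := by
  have key (d : A) : (Set.range fun y => star d * y) = star '' (Set.range fun y => y * d) := by
    ext z
    constructor
    · rintro ⟨y, rfl⟩
      exact ⟨_, ⟨star y, rfl⟩, by simp⟩
    · rintro ⟨_, ⟨y, rfl⟩, rfl⟩
      exact ⟨star y, by simp⟩
  rw [key, key, star_injective.image_injective.eq_iff]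

theorem isCoreInv_star_iff {A : Type*} [Ring A] [StarRing A] {a x : A} :
    IsCoreInv (star a) (star x) ↔ IsDualCoreInv a x := by
  have h1 : star a * star x * star a = star a ↔ a * x * a = a := by
    rw [← star_mul, ← star_mul, star_inj, mul_assoc]
  have h2 := range_star_mul_eq_iff (b := star x) (c := star (star a))
  simp only [star_star] at h2
  rw [IsCoreInv, IsDualCoreInv, h1, range_star_mul_eq_iff, star_star, h2]
  tauto

theorem exists_isCoreInv_star_iff {A : Type*} [Ring A] [StarRing A] {a : A} :
    (∃ x, IsCoreInv (star a) x) ↔ ∃ x, IsDualCoreInv a x := by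
  rw [star_involutive.surjective.exists]
  simp only [isCoreInv_star_iff]

section CStar

variable {A : Type*} [NormedRing A] [StarRing A] [CStarRing A]
  [CompleteSpace A] [NormedAlgebra ℂ A] [StarModule ℂ A]

theorem IsSelfAdjoint.isUnit_one_add_sq {w : A} (hw : IsSelfAdjoint w) : IsUnit (1 + w * w) := by
  let _ : CStarAlgebra A := {}
  have hz (z : ℂ) (hz : z.im ≠ 0) : IsUnit (algebraMap ℂ A z - w) := by
    by_contra h
    exact hz (hw.im_eq_zero_of_mem_spectrum h)
  have h := (hz Complex.I (by simp)).mul (hz (-Complex.I) (by simp))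
  have hI : algebraMap ℂ A Complex.I * algebraMap ℂ A Complex.I = -1 := by
    rw [← map_mul, Complex.I_mul_I, map_neg, map_one]
  convert h using 1
  rw [map_neg, sub_mul, mul_sub, mul_sub, mul_neg, mul_neg, hI, Algebra.commutes Complex.I w]
  abel

/-- The range projection of an idempotent in a C⋆-algebra. -/
theorem exists_isSelfAdjoint_of_isIdempotentElem {p : A} (hp : IsIdempotentElem p) :
    ∃ q : A, IsSelfAdjoint q ∧ p * q = q ∧ q * p = p := by
  have hp : p * p = p := hp
  have hps : star p * star p = star p := by rw [← star_mul, hp]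
  have hw : IsSelfAdjoint (Complex.I • (p - star p)) := by
    rw [IsSelfAdjoint, star_smul, star_sub, star_star, Complex.star_def, Complex.conj_I,
      neg_smul, ← smul_neg, neg_sub]
  obtain ⟨z, hz⟩ := hw.isUnit_one_add_sq
  have hz : (z : A) = 1 - p - star p + p * star p + star p * p := by
    rw [hz, smul_mul_smul_comm, Complex.I_mul_I, neg_one_smul, sub_mul, mul_sub, mul_sub, hp, hps]
    abel
  have hpz : p * z = p * star p * p := by
    simp only [hz, mul_add, mul_sub, mul_one, ← mul_assoc, hp]
    abel
  have hzp : z * p = p * star p * p := by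
    simp only [hz, add_mul, sub_mul, one_mul, mul_assoc, hp]
    abel
  have hzs : star (z : A) = z := by
    simp only [hz, star_add, star_sub, star_one, star_mul, star_star]
    abel
  have hc : Commute p z := hpz.trans hzp.symm
  have hcs : Commute (star p) z := by simpa [hzs] using hc.star_star
  have hzis : star (↑z⁻¹ : A) = ↑z⁻¹ := by
    rw [← Units.coe_star, star_inv, (Units.ext hzs : star z = z)]
  have hci := hc.units_inv_right
  refine ⟨p * star p * ↑z⁻¹, ?_, ?_, ?_⟩
  · rw [IsSelfAdjoint, star_mul, star_mul, star_star, hzis]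
    exact ((hci.mul_left hcs.units_inv_right).eq).symm
  · rw [← mul_assoc, ← mul_assoc, hp]
  · rw [mul_assoc, ← hci.eq, ← mul_assoc, ← hpz, Units.mul_inv_cancel_right]

theorem IsGroupInv.exists_isCoreInv {a g : A} (h : IsGroupInv a g) : ∃ x, IsCoreInv a x := by
  obtain ⟨h1, h2, h3⟩ := h
  have hp : IsIdempotentElem (a * g) := by rw [IsIdempotentElem, ← mul_assoc, h1]
  obtain ⟨q, hq, hpq, hqp⟩ := exists_isSelfAdjoint_of_isIdempotentElem hp
  have hqa : q * a = a := by
    rw [← h1, ← mul_assoc, hqp]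
  have hqq : q * q = q := by
    calc q * q = q * (a * g) * q := by rw [mul_assoc, hpq]
      _ = q := by rw [hqp, hpq]
  have hax : a * (g * q) = q := by rw [← mul_assoc, hpq]
  have hgaa : g * a * a = a := by rw [← h3, h1]
  have hagg : a * g * g = g := by rw [h3, h2]
  refine ⟨g * q, by rw [hax, hqa], ?_, ?_⟩
  · ext z
    constructor
    · rintro ⟨y, rfl⟩
      exact ⟨g * (g * q * y), by simp only [← mul_assoc, hagg]⟩
    · rintro ⟨y, rfl⟩
      refine ⟨a * a * y, ?_⟩
      change g * q * (a * a * y) = a * y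
      calc g * q * (a * a * y) = g * (q * a) * a * y := by simp only [mul_assoc]
        _ = a * y := by rw [hqa, hgaa]
  · have hx : g * q * star (g * q) * star a = g * q := by
      rw [mul_assoc, ← star_mul, hax, hq.star_eq, mul_assoc, hqq]
    have ha : star a * a * (g * q) = star a := by
      rw [mul_assoc, hax]
      nth_rewrite 1 [← hq.star_eq]
      rw [← star_mul, hqa]
    ext z
    constructor
    · rintro ⟨y, rfl⟩
      exact ⟨y * (g * q * star (g * q)), by simp only [mul_assoc] at hx ⊢; rw [hx]⟩
    · rintro ⟨y, rfl⟩
      exact ⟨y * (star a * a), by simp only [mul_assoc] at ha ⊢; rw [ha]⟩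

/-- Regular elements of a C⋆-algebra are Moore–Penrose invertible (Harte–Mbekhta). -/
theorem exists_isMPInv_of_mul_mul_eq {a g : A} (h : a * g * a = a) : ∃ x, IsMPInv a x := by
  have hp : IsIdempotentElem (a * g) := by rw [IsIdempotentElem, ← mul_assoc, h]
  have hp' : IsIdempotentElem (star (g * a)) := by
    rw [IsIdempotentElem, ← star_mul, mul_assoc, ← mul_assoc a, h]
  obtain ⟨q, hq, hpq, hqp⟩ := exists_isSelfAdjoint_of_isIdempotentElem hp
  obtain ⟨r, hr, hpr, hrp⟩ := exists_isSelfAdjoint_of_isIdempotentElem hp'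
  have hrp' : r * (g * a) = r := by
    simpa [hr.star_eq, mul_assoc] using congrArg star hpr
  have hpr' : g * a * r = g * a := by
    simpa [hr.star_eq, mul_assoc] using congrArg star hrp
  have hqa : q * a = a := by
    rw [← h, ← mul_assoc, hqp]
  have har : a * r = a := by
    calc a * r = a * (g * a * r) := by rw [← mul_assoc, ← mul_assoc, h]
      _ = a := by rw [hpr', ← mul_assoc, h]
  have hrr : r * r = r := by
    calc r * r = r * (g * a * r) := by rw [← mul_assoc, hrp']
      _ = r := by rw [hpr', hrp']
  have hax : a * (r * g * q) = q := by rw [← mul_assoc, ← mul_assoc, har, hpq]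
  have hxa : r * g * q * a = r := by rw [mul_assoc, hqa, mul_assoc, hrp']
  refine ⟨r * g * q, ?_, ?_, ?_, ?_⟩
  · rw [hax, hqa]
  · rw [hxa, ← mul_assoc, ← mul_assoc, hrr]
  · rw [hax, hq.star_eq]
  · rw [hxa, hr.star_eq]

theorem exists_isCoreInv_iff_exists_isGroupInv {a : A} :
    (∃ x, IsCoreInv a x) ↔ ∃ x, IsGroupInv a x :=
  ⟨fun ⟨_, h⟩ => h.exists_isGroupInv, fun ⟨_, h⟩ => h.exists_isCoreInv⟩

theorem exists_isCoreInv_star_iff_exists_isCoreInv {a : A} :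
    (∃ x, IsCoreInv (star a) x) ↔ ∃ x, IsCoreInv a x := by
  rw [exists_isCoreInv_iff_exists_isGroupInv, exists_isCoreInv_iff_exists_isGroupInv]
  exact ⟨fun ⟨g, h⟩ => ⟨star g, by simpa using isGroupInv_star h⟩, fun ⟨g, h⟩ => ⟨star g, isGroupInv_star h⟩⟩

theorem exists_isCoreInv_iff_exists_isDualCoreInv {a : A} :
    (∃ x, IsCoreInv a x) ↔ ∃ x, IsDualCoreInv a x := by
  rw [← exists_isCoreInv_star_iff, exists_isCoreInv_star_iff_exists_isCoreInv]

end CStar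

theorem stmt0 {A : Type*} [NormedRing A] [StarRing A] [CStarRing A]
    [CompleteSpace A] [NormedAlgebra ℂ A] [StarModule ℂ A] (a : A) :
    ((∃ x, IsCoreInv a x) ↔ (∃ x, IsDualCoreInv a x)) ∧
    ((∃ x, IsCoreInv a x) ↔ (∃ x, IsCoreInv (star a) x)) ∧
    ((∃ x, IsCoreInv a x) ↔ (∃ x, IsDualCoreInv (star a) x)) ∧
    ((∃ x, IsCoreInv a x) ↔ ((∃ x, IsGroupInv a x) ∧ (∃ x, IsMPInv a x))) ∧
    {b : A | ∃ x, IsCoreInv b x} = {b : A | ∃ x, IsDualCoreInv b x} ∧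
    {b : A | ∃ x, IsCoreInv b x} = {b : A | ∃ x, IsGroupInv b x} := by
  refine ⟨exists_isCoreInv_iff_exists_isDualCoreInv,
    exists_isCoreInv_star_iff_exists_isCoreInv.symm, ?_, ?_, ?_, ?_⟩
  · rw [← exists_isCoreInv_star_iff, star_star]
  · rw [exists_isCoreInv_iff_exists_isGroupInv]
    exact ⟨fun h => ⟨h, exists_isMPInv_of_mul_mul_eq h.choose_spec.1⟩, fun h => h.1⟩
  · ext b
    exact exists_isCoreInv_iff_exists_isDualCoreInv
  · ext b
    exact exists_isCoreInv_iff_exists_isGroupInv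
end

section
/- Let A be a unital C*-algebra and let a ∈ A be core invertible. Then (a·a† + a†·a − 1)·a⊕ = a†. -/
open scoped Classical

/-- The Moore–Penrose inverse `a†` (or `0` if it does not exist). -/
noncomputable def mpInv {A : Type*} [Ring A] [StarRing A] (a : A) : A :=
  if h : ∃ x, IsMPInv a x then h.choose else 0

/-- The group inverse `a#` (or `0` if it does not exist). -/
noncomputable def groupInv {A : Type*} [Ring A] (a : A) : A :=
  if h : ∃ x, IsGroupInv a x then h.choose else 0

/-- The core inverse `a⊕` (or `0` if it does not exist). -/
noncomputable def coreInv {A : Type*} [Ring A] [StarRing A] (a : A) : A :=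
  if h : ∃ x, IsCoreInv a x then h.choose else 0

/-- The dual core inverse `a⊖` (or `0` if it does not exist). -/
noncomputable def dualCoreInv {A : Type*} [Ring A] [StarRing A] (a : A) : A :=
  if h : ∃ x, IsDualCoreInv a x then h.choose else 0

/-- The maximal angle `ψ_a ∈ [0, π/2]` between `a·a†` and `a†·a`, defined by
`sin ψ_a = ‖a·a† − a†·a‖` (and `ψ_a = 0` when `a = 0`). -/
noncomputable def maxAngle {A : Type*} [NormedRing A] [StarRing A] (a : A) : ℝ :=
  Real.arcsin ‖a * mpInv a - mpInv a * a‖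

/-- `δ(M, N)`: zero if `M = {0}`, otherwise the supremum of distances from
norm-one elements of `M` to `N`. -/
noncomputable def subDelta {E : Type*} [NormedAddCommGroup E] (M N : Set E) : ℝ :=
  if M = {0} then 0
  else sSup ((fun m => Metric.infDist m N) '' {m ∈ M | ‖m‖ = 1})

/-- The gap `θ(M, N)` between the subspaces `M` and `N`. -/
noncomputable def subGap {E : Type*} [NormedAddCommGroup E] (M N : Set E) : ℝ :=
  max (subDelta M N) (subDelta N M)

/-- The right ideal `a·A`. -/
def rIdeal {A : Type*} [Ring A] (a : A) : Set A := Set.range fun y => a * y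

/-- The left ideal `A·a`. -/
def lIdeal {A : Type*} [Ring A] (a : A) : Set A := Set.range fun y => y * a

/-- The right annihilator `a° = {x : a·x = 0}`. -/
def rAnn {A : Type*} [Ring A] (a : A) : Set A := {x | a * x = 0}

/-- The left annihilator `°a = {x : x·a = 0}`. -/
def lAnn {A : Type*} [Ring A] (a : A) : Set A := {x | x * a = 0}

/-- In a unital C⋆-algebra, `1 + b²` is invertible for self-adjoint `b`. -/
theorem IsSelfAdjoint.isUnit_one_add_mul_self {A : Type*} [CStarAlgebra A] {b : A}
    (hb : IsSelfAdjoint b) : IsUnit (1 + b * b) := by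
  have key : ∀ c : ℂ, c.im ≠ 0 → IsUnit (algebraMap ℂ A c - b) := by
    intro c hc
    by_contra h
    exact hc (hb.im_eq_zero_of_mem_spectrum h)
  have h := (key Complex.I (by simp)).mul (key (-Complex.I) (by simp))
  convert h using 1
  have hcomm := Algebra.commutes Complex.I b
  have hI : algebraMap ℂ A Complex.I * algebraMap ℂ A Complex.I = -1 := by
    rw [← map_mul, Complex.I_mul_I, map_neg, map_one]
  simp only [map_neg, sub_mul, mul_sub, mul_neg, hI, hcomm]
  abel

/-- The right support projection of an idempotent in a unital C⋆-algebra. -/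
theorem exists_isSelfAdjoint_mul_eq_of_isIdempotentElem {A : Type*} [CStarAlgebra A]
    {p : A} (hp : IsIdempotentElem p) : ∃ q : A, IsSelfAdjoint q ∧ p * q = p ∧ q * p = q := by
  have hp' : p * p = p := hp
  have hs : star p * star p = star p := by rw [← star_mul, hp']
  have hb : IsSelfAdjoint (Complex.I • (p - star p)) := by
    simp [IsSelfAdjoint, star_smul, ← smul_neg]
  obtain ⟨u, hu⟩ := hb.isUnit_one_add_mul_self
  have hz : (u : A) = 1 - p - star p + p * star p + star p * p := by
    rw [hu, smul_mul_smul_comm, Complex.I_mul_I, neg_one_smul]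
    simp only [sub_mul, mul_sub, hp', hs]
    abel
  have hpz : p * u = p * star p * p := by
    rw [hz]
    simp only [mul_add, mul_sub, mul_one, ← mul_assoc, hp']
    abel
  have hzp : u * p = p * star p * p := by
    rw [hz]
    simp only [add_mul, sub_mul, one_mul, mul_assoc, hp']
    abel
  have hsu : star (u : A) = u := by
    rw [hz]
    simp only [star_add, star_sub, star_mul, star_star, star_one]
    abel
  have hc : Commute p (u : A) := hpz.trans hzp.symm
  have hcs : Commute (star p) (u : A) := by simpa only [hsu] using hc.star_star
  have hinv : Commute p (↑u⁻¹ : A) := hc.units_inv_right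
  have hinvs : Commute (star p) (↑u⁻¹ : A) := hcs.units_inv_right
  have hsinv : star (↑u⁻¹ : A) = ↑u⁻¹ := by
    have : star u = u := Units.ext hsu
    rw [← Units.coe_star, star_inv, this]
  refine ⟨star p * p * ↑u⁻¹, ?_, ?_, ?_⟩
  · rw [IsSelfAdjoint, star_mul, star_mul, star_star, hsinv]
    exact (hinvs.mul_left hinv).eq.symm
  · rw [← mul_assoc, ← mul_assoc, ← hpz, Units.mul_inv_cancel_right]
  · rw [mul_assoc, ← hinv.eq, ← mul_assoc, mul_assoc (star p), hp']

section CoreInverse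

variable {A : Type*} [Ring A] [StarRing A] {a x y : A}

theorem IsCoreInv.star_mul_eq_and_mul_mul_eq (h : IsCoreInv a x) :
    star (a * x) = a * x ∧ x * a * x = x := by
  obtain ⟨h1, -, h3⟩ := h
  obtain ⟨u, hu⟩ : x ∈ Set.range fun y => y * star a := h3 ▸ ⟨1, one_mul x⟩
  dsimp only at hu
  have hx : x * star (a * x) = x := by
    calc x * star (a * x) = u * (star a * star (a * x)) := by rw [← mul_assoc, hu]
      _ = x := by rw [← star_mul, h1, hu]
  have hax : star (a * x) = a * x := by
    have h : a * x * star (a * x) = a * x := by rw [mul_assoc, hx]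
    rw [← h, star_mul, star_star]
  refine ⟨hax, ?_⟩
  rw [mul_assoc, ← hax, hx]

/-- A core inverse of `a` determines any Moore–Penrose inverse of `a`. -/
theorem IsMPInv.add_sub_one_mul_coreInv (hy : IsMPInv a y) (hx : IsCoreInv a x) :
    (a * y + y * a - 1) * x = y := by
  obtain ⟨y1, y2, y3, -⟩ := hy
  obtain ⟨x3, -⟩ := hx.star_mul_eq_and_mul_mul_eq
  obtain ⟨x1, hr, -⟩ := hx
  obtain ⟨s, hs⟩ : x ∈ Set.range fun y => a * y := hr ▸ ⟨1, mul_one x⟩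
  dsimp only at hs
  have hayx : a * y * x = x := by rw [← hs, ← mul_assoc, y1]
  have hax : a * x = a * y := by
    calc a * x = star (a * x) := x3.symm
      _ = star (a * y * (a * x)) := by rw [← mul_assoc, y1]
      _ = a * x * (a * y) := by rw [star_mul, x3, y3]
      _ = a * y := by rw [← mul_assoc, x1]
  rw [sub_mul, add_mul, hayx, one_mul, add_sub_cancel_left, mul_assoc, hax, ← mul_assoc, y2]

end CoreInverse

/-- A core invertible element of a unital C⋆-algebra is Moore–Penrose invertible. -/
theorem IsCoreInv.exists_isMPInv {A : Type*} [CStarAlgebra A] {a x : A} (h : IsCoreInv a x) :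
    ∃ y, IsMPInv a y := by
  obtain ⟨h3, h2⟩ := h.star_mul_eq_and_mul_mul_eq
  have h1 := h.1
  have hp : IsIdempotentElem (x * a) := by
    rw [IsIdempotentElem, ← mul_assoc, h2]
  obtain ⟨q, hq, hpq, hqp⟩ := exists_isSelfAdjoint_mul_eq_of_isIdempotentElem hp
  have haq : a * q = a := by
    calc a * q = a * (x * a * q) := by rw [← mul_assoc, ← mul_assoc, h1]
      _ = a := by rw [hpq, ← mul_assoc, h1]
  have haqx : a * (q * x) = a * x := by rw [← mul_assoc, haq]
  have hqxa : q * x * a = q := by rw [mul_assoc, hqp]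
  have hqq : q * q = q := by
    calc q * q = q * (x * a) * q := by rw [hqp]
      _ = q := by rw [mul_assoc, hpq, hqp]
  refine ⟨q * x, ?_, ?_, ?_, ?_⟩
  · rw [haqx, h1]
  · rw [hqxa, ← mul_assoc, hqq]
  · rw [haqx, h3]
  · rw [hqxa, hq.star_eq]

theorem stmt2 {A : Type*} [NormedRing A] [StarRing A] [CStarRing A]
    [CompleteSpace A] [NormedAlgebra ℂ A] [StarModule ℂ A]
    (a : A) (ha : ∃ x, IsCoreInv a x) :
    (a * mpInv a + mpInv a * a - 1) * coreInv a = mpInv a := by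
  let _ : CStarAlgebra A := {}
  have hx : IsCoreInv a (coreInv a) := by
    rw [coreInv, dif_pos ha]
    exact ha.choose_spec
  have hm : ∃ y, IsMPInv a y := hx.exists_isMPInv
  have hy : IsMPInv a (mpInv a) := by
    rw [mpInv, dif_pos hm]
    exact hm.choose_spec
  exact hy.add_sub_one_mul_coreInv hx
end

section
/- Let A be a unital C*-algebra and let a ∈ A be dual core invertible. Then a is group invertible and a# = a·(a⊖)². -/
open scoped Classical

theorem IsGroupInv.unique {A : Type*} [Ring A] {a x y : A} (hx : IsGroupInv a x)
    (hy : IsGroupInv a y) : x = y := by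
  obtain ⟨hx₁, hx₂, hx₃⟩ := hx
  obtain ⟨hy₁, hy₂, hy₃⟩ := hy
  have h : a * x = a * y := by
    calc a * x = a * y * (a * x) := by rw [← mul_assoc, hy₁]
      _ = y * (a * x * a) := by rw [hy₃, mul_assoc, mul_assoc a x, ← hx₃]
      _ = a * y := by rw [hx₁, hy₃]
  calc x = x * (a * x) := by rw [← mul_assoc, hx₂]
    _ = x * a * y := by rw [h, mul_assoc]
    _ = y := by rw [← hx₃, h, hy₃, hy₂]

theorem IsDualCoreInv.isGroupInv {A : Type*} [Ring A] [StarRing A] {a x : A}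
    (h : IsDualCoreInv a x) : IsGroupInv a (a * x ^ 2) := by
  obtain ⟨haxa, hr, hl⟩ := h
  obtain ⟨p, hp⟩ : x ∈ Set.range fun y => star a * y := hr ▸ ⟨1, mul_one x⟩
  obtain ⟨u, hu⟩ : x ∈ Set.range fun y => y * a := hl ▸ ⟨1, one_mul x⟩
  obtain ⟨v, hv⟩ : a ∈ Set.range fun y => y * x := hl ▸ ⟨1, one_mul a⟩
  dsimp only at hp hu hv
  have hxxa : x * (x * a) = x := by
    calc x * (x * a) = u * (a * x * a) := by
          nth_rw 1 [← hu]; simp only [mul_assoc]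
      _ = x := by rw [haxa, hu]
  have hstar : star (x * a) * x = x := by
    calc star (x * a) * x = star (a * x * a) * p := by
          nth_rw 2 [← hp]; simp only [star_mul, mul_assoc]
      _ = x := by rw [haxa, hp]
  have hself : star (x * a) = x * a := by
    have h : star (x * a) * (x * a) = x * a := by rw [← mul_assoc, hstar]
    rw [← h, star_mul, star_star]
  have hxax : x * a * x = x := by rw [← hself, hstar]
  have haax : a * (a * x) = a := by
    calc a * (a * x) = v * (x * a * x) := by nth_rw 1 [← hv]; simp only [mul_assoc]
      _ = a := by rw [hxax, hv]
  have hleft : a * (a * x ^ 2) = a * x := by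
    rw [pow_two, ← mul_assoc a x x, ← mul_assoc, haax]
  have hright : a * x ^ 2 * a = a * x := by
    rw [pow_two, mul_assoc, mul_assoc, hxxa]
  refine ⟨by rw [hleft, haxa], ?_, by rw [hleft, hright]⟩
  rw [hright, pow_two, ← mul_assoc, haxa]

theorem stmt4 {A : Type*} [NormedRing A] [StarRing A] [CStarRing A]
    [CompleteSpace A] [NormedAlgebra ℂ A] [StarModule ℂ A]
    (a : A) (ha : ∃ x, IsDualCoreInv a x) :
    (∃ x, IsGroupInv a x) ∧ groupInv a = a * dualCoreInv a ^ 2 := by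
  have hdual : IsDualCoreInv a (dualCoreInv a) := by
    rw [dualCoreInv, dif_pos ha]
    exact ha.choose_spec
  have hex : ∃ x, IsGroupInv a x := ⟨_, hdual.isGroupInv⟩
  refine ⟨hex, ?_⟩
  rw [groupInv, dif_pos hex]
  exact hex.choose_spec.unique hdual.isGroupInv
end

section
/- Let A be a unital C*-algebra and let a, b ∈ A be core invertible. Then b⊕ − a⊕ = b⊕·b·(b† − a†)·(1 − a·a⊕) + b⊕·(a − b)·a⊕ + (1 − b⊕·b)·(b − a)·a†·a⊕. -/
open scoped Classical

theorem IsCoreInv.identities {A : Type*} [Ring A] [StarRing A] {a x : A} (h : IsCoreInv a x) :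
    a * x * a = a ∧ x * a * x = x ∧ star (a * x) = a * x ∧ x * a * a = a ∧ a * x * x = x := by
  obtain ⟨h1, h2, h3⟩ := h
  obtain ⟨u, hu⟩ : x ∈ Set.range fun y => a * y := h2 ▸ ⟨1, mul_one x⟩
  obtain ⟨v, hv⟩ : a ∈ Set.range fun y => x * y := h2 ▸ ⟨1, mul_one a⟩
  obtain ⟨w, hw⟩ : x ∈ Set.range fun y => y * star a := h3 ▸ ⟨1, one_mul x⟩
  dsimp only at hu hv hw
  have h4 : x * star (a * x) = x := by
    calc x * star (a * x) = w * (star a * star (a * x)) := by rw [← mul_assoc, hw]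
      _ = x := by rw [← star_mul, h1, hw]
  have h5 : star (a * x) = a * x := by
    have h6 : a * x * star (a * x) = a * x := by rw [mul_assoc, h4]
    have h7 := congrArg star h6
    rw [star_mul, star_star, h6] at h7
    exact h7.symm
  have h8 : x * a * x = x := by rw [mul_assoc, ← h5, h4]
  refine ⟨h1, h8, h5, ?_, ?_⟩
  · calc x * a * a = x * a * x * v := by rw [mul_assoc (x * a) x v, hv]
      _ = a := by rw [h8, hv]
  · calc a * x * x = a * x * a * u := by rw [mul_assoc (a * x) a u, hu]
      _ = x := by rw [h1, hu]

theorem isUnit_one_add_star_mul_self {A : Type*} [CStarAlgebra A] (c : A) :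
    IsUnit (1 + star c * c) := by
  have h : (-1 : ℝ) ∉ spectrum ℝ (star c * c) := fun hc => by
    have := spectrum_star_mul_self_nonneg (b := c) (-1) hc
    norm_num at this
  rw [spectrum.notMem_iff] at h
  simpa [sub_eq_add_neg, add_comm] using h.neg

/-- An idempotent of a C⋆-algebra generates the same left ideal as some projection. -/
theorem exists_star_eq_of_mul_self_eq {A : Type*} [CStarAlgebra A] {e : A}
    (he : e * e = e) : ∃ q : A, star q = q ∧ e * q = e ∧ q * e = q := by
  obtain ⟨h, hh⟩ := isUnit_one_add_star_mul_self (e - star e)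
  have hs : star e * star e = star e := by rw [← star_mul, he]
  have hexp : (h : A) = 1 - e - star e + e * star e + star e * e := by
    rw [hh, star_sub, star_star]
    simp only [sub_mul, mul_sub, he, hs]
    abel
  have hle : (h : A) * e = e * star e * e := by
    rw [hexp]
    simp only [sub_mul, add_mul, one_mul, mul_assoc, he]
    abel
  have hre : e * (h : A) = e * star e * e := by
    rw [hexp]
    simp only [sub_eq_add_neg, mul_add, mul_neg, mul_one, ← mul_assoc, he]
    abel
  have hstar : star (h : A) = h := by
    rw [hexp]
    simp only [star_add, star_sub, star_mul, star_star, star_one]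
    abel
  have hcomm : Commute (h : A) e := hle.trans hre.symm
  have hcomm' : Commute (h : A) (star e) := by
    have := hcomm.star_star
    rwa [hstar] at this
  have hi : Commute (↑h⁻¹ : A) e := hcomm.units_inv_left
  have hi' : Commute (↑h⁻¹ : A) (star e) := hcomm'.units_inv_left
  have hinv : star (↑h⁻¹ : A) = ↑h⁻¹ := by
    have h1 : star (↑h⁻¹ : A) * h = 1 := by
      rw [← hstar, ← star_mul, Units.mul_inv, star_one]
    exact Units.eq_inv_of_mul_eq_one_right h1
  refine ⟨star e * e * ↑h⁻¹, ?_, ?_, ?_⟩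
  · rw [star_mul, star_mul, star_star, hinv]
    exact (hi'.mul_right hi).eq
  · rw [← mul_assoc, ← mul_assoc, ← hre, mul_assoc, Units.mul_inv, mul_one]
  · rw [mul_assoc, hi.eq, mul_assoc, ← mul_assoc e e, he, mul_assoc]

/-- The core and Moore–Penrose inverses define the same range projection. -/
theorem IsCoreInv.mul_eq_mul_of_isMPInv {A : Type*} [Ring A] [StarRing A] {a x y : A}
    (h : IsCoreInv a x) (hy : IsMPInv a y) : a * x = a * y := by
  obtain ⟨h1, -, h3, -, -⟩ := h.identities
  obtain ⟨k1, -, k3, -⟩ := hy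
  calc a * x = star (a * y * (a * x)) := by rw [← mul_assoc, k1, h3]
    _ = a * y := by rw [star_mul, h3, k3, ← mul_assoc, h1]

theorem isCoreInv_coreInv {A : Type*} [Ring A] [StarRing A] {a : A}
    (h : ∃ x, IsCoreInv a x) : IsCoreInv a (coreInv a) := by
  rw [coreInv, dif_pos h]
  exact h.choose_spec

theorem isMPInv_mpInv {A : Type*} [Ring A] [StarRing A] {a : A}
    (h : ∃ x, IsMPInv a x) : IsMPInv a (mpInv a) := by
  rw [mpInv, dif_pos h]
  exact h.choose_spec

theorem IsCoreInv.sub_eq {A : Type*} [Ring A] [StarRing A] {a b x y z w : A}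
    (hx : IsCoreInv a x) (hy : IsMPInv a y) (hz : IsCoreInv b z) (hw : IsMPInv b w) :
    z - x = z * b * (w - y) * (1 - a * x) + z * (a - b) * x + (1 - z * b) * (b - a) * y * x := by
  have hay := hx.mul_eq_mul_of_isMPInv hy
  have hbw := hz.mul_eq_mul_of_isMPInv hw
  obtain ⟨-, -, -, -, h5⟩ := hx.identities
  obtain ⟨-, k2, -, k4, -⟩ := hz.identities
  have hyax : y * (1 - a * x) = 0 := by
    rw [hay, mul_sub, mul_one, ← mul_assoc, hy.2.1, sub_self]
  have hzbw : z * b * w = z := by rw [mul_assoc, ← hbw, ← mul_assoc, k2]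
  have hzb : (1 - z * b) * b = 0 := by rw [sub_mul, one_mul, k4, sub_self]
  have hfirst : z * b * (w - y) * (1 - a * x) = z - z * a * x := by
    rw [mul_sub (z * b) w, sub_mul, hzbw, mul_assoc _ y, hyax, mul_zero, sub_zero, mul_sub, mul_one,
      mul_assoc z a x]
  have hlast : (1 - z * b) * (b - a) * y * x = -(x - z * b * x) := by
    rw [mul_sub, hzb, zero_sub, neg_mul, neg_mul, mul_assoc _ a y, ← hay, mul_assoc, h5,
      sub_mul, one_mul]
  rw [hfirst, hlast, mul_sub, sub_mul]
  abel

theorem stmt9 {A : Type*} [NormedRing A] [StarRing A] [CStarRing A]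
    [CompleteSpace A] [NormedAlgebra ℂ A] [StarModule ℂ A]
    (a b : A) (ha : ∃ x, IsCoreInv a x) (hb : ∃ x, IsCoreInv b x) :
    coreInv b - coreInv a =
      coreInv b * b * (mpInv b - mpInv a) * (1 - a * coreInv a) +
        coreInv b * (a - b) * coreInv a +
        (1 - coreInv b * b) * (b - a) * mpInv a * coreInv a := by
  let _ : CStarAlgebra A := {}
  obtain ⟨x, hx⟩ := ha
  obtain ⟨z, hz⟩ := hb
  exact (isCoreInv_coreInv ⟨x, hx⟩).sub_eq (isMPInv_mpInv hx.exists_isMPInv)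
    (isCoreInv_coreInv ⟨z, hz⟩) (isMPInv_mpInv hz.exists_isMPInv)
end
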